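/- (Generalized regret bound for QuantumBoost.) Let X be a finite set with |X| = m, ε ∈ (0,1), γ ∈ (0,1/2], ζ ≥ 0, and T a positive integer. Let ℓ^1,…,ℓ^T : X → {0,1} be Boolean loss vectors and D^1,…,D^{T+1} probability distributions on X with strictly positive entries. For each t, let D̂^{t+1}(x) = D^t(x)(1−γ)^{ℓ^t(x)}/Z_t with Z_t = 1 − γ⟨D^t,ℓ^t⟩ be the multiplicative update of D^t. Let P ⊆ {1,…,T} with |P| = R be a set of projection rounds such that: for t ∉ P, D^{t+1} = D̂^{t+1}; and for t ∈ P, RE(D||D^{t+1}) ≤ RE(D||D̂^{t+1}) + ζ for every ε-smooth distribution D on X. Then for every ε-smooth distribution D on X: ∑_{t=1}^T ⟨D^t, ℓ^t⟩ ≤ (1+γ)·∑_{t=1}^T ⟨D, ℓ^t⟩ + Rζ/γ + RE(D||D^1)/γ. -/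

import Mathlib

theorem neg_log_one_sub_le {γ : ℝ} (h0 : 0 < γ) (h1 : γ ≤ 1 / 2) :
    -Real.log (1 - γ) ≤ γ * (1 + γ) := by
  have hpos : 0 < 1 - γ := by linarith
  rw [← Real.log_inv, Real.log_le_iff_le_exp (inv_pos.2 hpos)]
  refine le_trans ?_ (Real.quadratic_le_exp_of_nonneg (by positivity))
  rw [inv_le_iff_one_le_mul₀ hpos]
  have h2 : γ ^ 2 ≤ 1 / 4 := by nlinarith
  have h3 : γ ^ 3 ≤ 1 / 8 := by nlinarith
  nlinarith [mul_nonneg (sq_nonneg γ) (by linarith : 0 ≤ 1 - γ - γ ^ 2 - γ ^ 3)]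

theorem sub_le_mul_log_div {x y : ℝ} (hx : 0 ≤ x) (hy : 0 < y) :
    x - y ≤ x * Real.log (x / y) := by
  rcases hx.eq_or_lt with rfl | hx
  · simpa using hy.le
  have h := Real.one_sub_inv_le_log_of_pos (div_pos hx hy)
  calc x - y = x * (1 - (x / y)⁻¹) := by field_simp
    _ ≤ _ := mul_le_mul_of_nonneg_left h hx.le

/-- Gibbs' inequality for finite distributions. -/
theorem sum_mul_log_div_nonneg {X : Type*} [Fintype X] {p q : X → ℝ} (hp : ∀ x, 0 ≤ p x)
    (hq : ∀ x, 0 < q x) (hpq : ∑ x, p x = ∑ x, q x) :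
    0 ≤ ∑ x, p x * Real.log (p x / q x) := by
  have h := Finset.sum_le_sum fun x (_ : x ∈ Finset.univ) => sub_le_mul_log_div (hp x) (hq x)
  rw [Finset.sum_sub_distrib] at h
  linarith

/-- Change in relative entropy under one multiplicative update. -/
theorem sum_mul_log_div_update_le {X : Type*} [Fintype X] {γ : ℝ} (hγ : 0 < γ) (hγ2 : γ ≤ 1 / 2)
    {p q : X → ℝ} {l : X → ℕ} (hl : ∀ x, l x ≤ 1) (hp : ∀ x, 0 ≤ p x) (hp1 : ∑ x, p x = 1)
    (hq : ∀ x, 0 < q x) (hq1 : ∑ x, q x = 1) :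
    ∑ x, p x * Real.log (p x / (q x * (1 - γ) ^ l x / (1 - γ * ∑ y, q y * (l y : ℝ))))
      ≤ ∑ x, p x * Real.log (p x / q x) + γ * (1 + γ) * ∑ x, p x * (l x : ℝ)
        - γ * ∑ x, q x * (l x : ℝ) := by
  have hle : ∑ y, q y * (l y : ℝ) ≤ 1 := by
    rw [← hq1]
    exact Finset.sum_le_sum fun x _ =>
      mul_le_of_le_one_right (hq x).le (by exact_mod_cast hl x)
  set a := ∑ y, q y * (l y : ℝ)
  have hZ : 0 < 1 - γ * a := by nlinarith
  have hγ1 : 0 < 1 - γ := by linarith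
  have hlogZ : Real.log (1 - γ * a) ≤ -(γ * a) := by
    linarith [Real.log_le_sub_one_of_pos hZ]
  have key : ∀ x, p x * Real.log (p x / (q x * (1 - γ) ^ l x / (1 - γ * a)))
      ≤ p x * Real.log (p x / q x) + γ * (1 + γ) * (p x * (l x : ℝ)) - p x * (γ * a) := by
    intro x
    rcases (hp x).eq_or_lt with h0 | h0
    · simp [← h0]
    have hpow : 0 < (1 - γ) ^ l x := pow_pos hγ1 _
    rw [Real.log_div h0.ne' (div_pos (mul_pos (hq x) hpow) hZ).ne',
      Real.log_div (mul_pos (hq x) hpow).ne' hZ.ne', Real.log_mul (hq x).ne' hpow.ne',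
      Real.log_pow, Real.log_div h0.ne' (hq x).ne']
    have h1 := mul_le_mul_of_nonneg_left (neg_log_one_sub_le hγ hγ2) (Nat.cast_nonneg (α := ℝ) (l x))
    have h2 := mul_le_mul_of_nonneg_left (add_le_add h1 hlogZ) h0.le
    linarith
  refine (Finset.sum_le_sum fun x _ => key x).trans_eq ?_
  rw [Finset.sum_sub_distrib, Finset.sum_add_distrib, ← Finset.mul_sum, ← Finset.sum_mul, hp1,
    one_mul]

/-- Generalized regret bound for QuantumBoost: With multiplicative
updates at every round and approximate projections (costing at most `ζ` in relative
entropy against any `ε`-smooth distribution) at the `R` rounds in `P`, for every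
`ε`-smooth distribution `D`:
`∑_{t=1}^T ⟨D^t,ℓ^t⟩ ≤ (1+γ)∑_{t=1}^T ⟨D,ℓ^t⟩ + Rζ/γ + RE(D||D^1)/γ`. -/
theorem stmt_10 {X : Type*} [Fintype X] [Nonempty X]
    (m : ℕ) (hm : Fintype.card X = m)
    (ε γ ζ : ℝ) (hε : 0 < ε) (hε1 : ε < 1) (hγ : 0 < γ) (hγ2 : γ ≤ 1 / 2) (hζ : 0 ≤ ζ)
    (T : ℕ) (hT : 0 < T)
    (ℓ : ℕ → X → ℕ) (hℓ : ∀ t x, ℓ t x ≤ 1)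
    (D : ℕ → X → ℝ)
    (hDpos : ∀ t ∈ Finset.Icc 1 (T + 1), ∀ x, 0 < D t x)
    (hDsum : ∀ t ∈ Finset.Icc 1 (T + 1), ∑ x, D t x = 1)
    (Dhat : ℕ → X → ℝ)
    (hDhat : ∀ t ∈ Finset.Icc 1 T, ∀ x,
      Dhat (t + 1) x = D t x * (1 - γ) ^ (ℓ t x)
        / (1 - γ * ∑ y, D t y * (ℓ t y : ℝ)))
    (P : Finset ℕ) (hP : P ⊆ Finset.Icc 1 T) (R : ℕ) (hR : P.card = R)
    (hnoproj : ∀ t ∈ Finset.Icc 1 T, t ∉ P → D (t + 1) = Dhat (t + 1))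
    (hproj : ∀ t ∈ Finset.Icc 1 T, t ∈ P →
      ∀ Dsm : X → ℝ, (∀ x, 0 ≤ Dsm x) → (∑ x, Dsm x = 1) →
        (∀ x, Dsm x ≤ 1 / (ε * m)) →
        ∑ x, Dsm x * Real.log (Dsm x / D (t + 1) x)
          ≤ (∑ x, Dsm x * Real.log (Dsm x / Dhat (t + 1) x)) + ζ) :
    ∀ Dsm : X → ℝ, (∀ x, 0 ≤ Dsm x) → (∑ x, Dsm x = 1) →
      (∀ x, Dsm x ≤ 1 / (ε * m)) →
      ∑ t ∈ Finset.Icc 1 T, ∑ x, D t x * (ℓ t x : ℝ)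
        ≤ (1 + γ) * ∑ t ∈ Finset.Icc 1 T, ∑ x, Dsm x * (ℓ t x : ℝ)
          + R * ζ / γ
          + (∑ x, Dsm x * Real.log (Dsm x / D 1 x)) / γ := by
  intro Dsm h0 h1 hs
  set E : ℕ → ℝ := fun t => ∑ x, Dsm x * Real.log (Dsm x / D t x) with hE
  have step : ∀ t ∈ Finset.Icc 1 T,
      γ * ∑ x, D t x * (ℓ t x : ℝ) ≤ γ * (1 + γ) * ∑ x, Dsm x * (ℓ t x : ℝ)
        + (if t ∈ P then ζ else 0) - (E (t + 1) - E t) := by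
    intro t ht
    have ht' : t ∈ Finset.Icc 1 (T + 1) := by
      rw [Finset.mem_Icc] at ht ⊢
      omega
    have hup := sum_mul_log_div_update_le hγ hγ2 (hℓ t) h0 h1 (hDpos t ht') (hDsum t ht')
    simp only [← hDhat t ht] at hup
    split_ifs with htP
    · have := hproj t ht htP Dsm h0 h1 hs
      simp only [hE]
      linarith
    · simp only [hE, hnoproj t ht htP]
      linarith
  have hsum := Finset.sum_le_sum step
  have htel : ∑ t ∈ Finset.Icc 1 T, (E (t + 1) - E t) = E (T + 1) - E 1 := by
    rw [← Finset.Ico_add_one_right_eq_Icc, Finset.sum_Ico_sub E (by omega)]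
  have hcount : ∑ t ∈ Finset.Icc 1 T, (if t ∈ P then ζ else 0) = R * ζ := by
    rw [Finset.sum_ite_mem, Finset.inter_eq_right.2 hP, Finset.sum_const, hR, nsmul_eq_mul]
  rw [Finset.sum_sub_distrib, Finset.sum_add_distrib, htel, hcount, ← Finset.mul_sum,
    ← Finset.mul_sum] at hsum
  have hlast : T + 1 ∈ Finset.Icc 1 (T + 1) := by simp
  have hnn : 0 ≤ E (T + 1) :=
    sum_mul_log_div_nonneg h0 (hDpos _ hlast) (h1.trans (hDsum _ hlast).symm)
  change _ ≤ _ + E 1 / γ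
  refine le_of_mul_le_mul_left ?_ hγ
  rw [mul_add, mul_add, mul_div_cancel₀ _ hγ.ne', mul_div_cancel₀ _ hγ.ne']
  linarith
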